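/- Let p > 5 be a prime and let ε = (5/p) be the Legendre symbol of 5 modulo p. Then 5 · (F_{p−ε}/p) ≡ 2 · (H_{⌊2p/5⌋} − H_{⌊p/5⌋}) (mod p), where H_n = ∑_{j=1}^{n} 1/j is the n-th harmonic number viewed as a rational number, and the congruence means equality in ℤ/pℤ after casting the rational number H_{⌊2p/5⌋} − H_{⌊p/5⌋} (whose denominator is coprime to p) into ℤ/pℤ. -/

import Mathlib

open Finset

/-- The part of the sum of `c j`, `0 < j < p`, over the indices with `j ≡ r * p (mod 5)`. -/
def residueSum {R : Type*} [CommRing R] (p : ℕ) (c : ℕ → R) (r : ZMod 5) : R :=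
  ∑ j ∈ (Ico 1 p).filter (fun j : ℕ => (j : ZMod 5) = r * p), c j

instance fact_prime_five : Fact (Nat.Prime 5) := ⟨Nat.prime_five⟩

section SquareZero

variable {R : Type*} [CommRing R] {p : ℕ} {c : ℕ → R}

lemma mul_choose_pred_eq (hp : p.Prime) (hp2 : (p : R) ^ 2 = 0) (k : ℕ) (hk : k < p) :
    (p : R) * ((p - 1).choose k : R) = p * (-1) ^ k := by
  induction k with
  | zero => simp
  | succ k ih =>
    have h1 : p.choose (k + 1) = (p - 1).choose k + (p - 1).choose (k + 1) := by
      conv_lhs => rw [← Nat.sub_add_cancel hp.one_le]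
      exact Nat.choose_succ_succ _ _
    obtain ⟨m, hm⟩ := hp.dvd_choose_self k.succ_ne_zero hk
    have h2 : ((p - 1).choose k : R) + ((p - 1).choose (k + 1) : R) = p * m := by
      exact_mod_cast congrArg (Nat.cast : ℕ → R) (h1.symm.trans hm)
    rw [pow_succ]
    linear_combination (p : R) * h2 - ih (by omega) + (m : R) * hp2

lemma one_sub_pow_prime (hp : p.Prime) (hp2 : (p : R) ^ 2 = 0) (hodd : Odd p)
    (hc : ∀ j ∈ Ico 1 p, (j : R) * c j = 1) (x : R) :
    (1 - x) ^ p = 1 - x ^ p - p * ∑ j ∈ Ico 1 p, c j * x ^ j := by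
  have hterm : ∀ j ∈ Ico 1 p,
      (-x) ^ j * 1 ^ (p - j) * (p.choose j : R) = -(p * (c j * x ^ j)) := by
    intro j hj
    have hcj := hc j hj
    obtain ⟨h1, h2⟩ := mem_Ico.mp hj
    obtain ⟨k, rfl⟩ : ∃ k, j = k + 1 := ⟨j - 1, by omega⟩
    have h3 : ((p.choose (k + 1) : R)) * ((k + 1 : ℕ) : R) = p * ((p - 1).choose k : R) := by
      have := Nat.add_one_mul_choose_eq (p - 1) k
      rw [Nat.sub_add_cancel hp.one_le] at this
      exact_mod_cast congrArg (Nat.cast : ℕ → R) this.symm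
    have h4 := mul_choose_pred_eq hp hp2 k (by omega)
    have h5 : ((-1 : R) ^ k) * (-1) ^ k = 1 := by rw [← mul_pow]; simp
    rw [neg_pow, pow_succ (-1 : R)]
    linear_combination ((-1 : R) ^ k * x ^ (k + 1)) * ((p.choose (k + 1) : R) * hcj
      - c (k + 1) * h3 - c (k + 1) * h4) - p * c (k + 1) * x ^ (k + 1) * h5
  rw [sub_eq_neg_add, add_pow, sum_range_succ, range_eq_Ico,
    sum_eq_sum_Ico_succ_bot hp.pos, sum_congr rfl hterm, sum_neg_distrib, ← mul_sum, hodd.neg_pow]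
  simp
  ring

lemma mul_residueSum_one_sub (hp2 : (p : R) ^ 2 = 0)
    (hc : ∀ j ∈ Ico 1 p, (j : R) * c j = 1) (r : ZMod 5) :
    (p : R) * residueSum p c (1 - r) = -(p * residueSum p c r) := by
  unfold residueSum
  rw [mul_sum, mul_sum, ← sum_neg_distrib]
  refine sum_nbij' (fun j => p - j) (fun j => p - j) ?_ ?_ ?_ ?_ ?_
  · intro j hj
    simp only [mem_filter, mem_Ico] at hj ⊢
    refine ⟨by omega, ?_⟩
    rw [Nat.cast_sub (by omega), hj.2]; ring
  · intro j hj
    simp only [mem_filter, mem_Ico] at hj ⊢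
    refine ⟨by omega, ?_⟩
    rw [Nat.cast_sub (by omega), hj.2]; ring
  · intro j hj
    simp only [mem_filter, mem_Ico] at hj ⊢
    omega
  · intro j hj
    simp only [mem_filter, mem_Ico] at hj ⊢
    omega
  · intro j hj
    simp only [mem_filter, mem_Ico] at hj
    have h1 := hc j (mem_Ico.mpr hj.1)
    have h2 := hc (p - j) (mem_Ico.mpr (by omega))
    rw [Nat.cast_sub (by omega)] at h2
    linear_combination (p : R) * c (p - j) * (-h1) - (p : R) * c j * h2
      + c j * c (p - j) * hp2

lemma mul_sum_mul_pow_eq (h5 : ¬ 5 ∣ p) (h2p : 2 < p) (hp2 : (p : R) ^ 2 = 0)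
    (hc : ∀ j ∈ Ico 1 p, (j : R) * c j = 1) {z : R} (hz : z ^ 5 = 1) :
    (p : R) * ∑ j ∈ Ico 1 p, c j * z ^ j =
      p * residueSum p c 0 * (1 - z ^ p) + p * residueSum p c 2 * ((z ^ p) ^ 2 - (z ^ p) ^ 4) := by
  have hsum : ∑ j ∈ Ico 1 p, c j * z ^ j = ∑ r : ZMod 5, residueSum p c r * (z ^ p) ^ r.val := by
    have hpz : (p : ZMod 5) ≠ 0 := by rwa [Ne, ZMod.natCast_eq_zero_iff]
    rw [← sum_fiberwise_of_maps_to (s := Ico 1 p) (t := univ)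
      (g := fun j : ℕ => (j : ZMod 5) / p) (fun _ _ => mem_univ _)]
    refine sum_congr rfl fun r _ => ?_
    simp only [residueSum, sum_mul, div_eq_iff hpz]
    refine sum_congr rfl fun j hj => ?_
    have hj2 : (j : ZMod 5) = ((p * r.val : ℕ) : ZMod 5) := by
      rw [(mem_filter.mp hj).2]; simp [mul_comm]
    rw [ZMod.natCast_eq_natCast_iff] at hj2
    rw [← pow_mul, pow_eq_pow_mod j hz, pow_eq_pow_mod (p * r.val) hz, hj2]
  have e0 := mul_residueSum_one_sub hp2 hc 0
  have e2 := mul_residueSum_one_sub hp2 hc 2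
  have e3 := mul_residueSum_one_sub hp2 hc 3
  have htwo := hc 2 (mem_Ico.mpr ⟨by norm_num, h2p⟩)
  rw [show (1 - 0 : ZMod 5) = 1 by decide] at e0
  rw [show (1 - 2 : ZMod 5) = 4 by decide] at e2
  rw [show (1 - 3 : ZMod 5) = 3 by decide] at e3
  push_cast at htwo
  rw [hsum]
  have hexp : ∑ r : ZMod 5, residueSum p c r * (z ^ p) ^ r.val =
      residueSum p c 0 * (z ^ p) ^ 0 + residueSum p c 1 * (z ^ p) ^ 1
      + residueSum p c 2 * (z ^ p) ^ 2 + residueSum p c 3 * (z ^ p) ^ 3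
      + residueSum p c 4 * (z ^ p) ^ 4 :=
    Fin.sum_univ_five (fun r : ZMod 5 => residueSum p c r * (z ^ p) ^ r.val)
  rw [hexp]
  linear_combination (z ^ p) * e0 + (z ^ p) ^ 4 * e2 + c 2 * (z ^ p) ^ 3 * e3
    - (z ^ p) ^ 3 * (p * residueSum p c 3) * htwo

lemma pow_five_eq_one {z : R} (hz : 1 + z + z ^ 2 + z ^ 3 + z ^ 4 = 0) : z ^ 5 = 1 := by
  linear_combination (z - 1) * hz

lemma geom_sum_pow_eq_zero {z : R} (hz : 1 + z + z ^ 2 + z ^ 3 + z ^ 4 = 0) {n : ℕ}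
    (hn : ¬ 5 ∣ n) :
    1 + z ^ n + (z ^ n) ^ 2 + (z ^ n) ^ 3 + (z ^ n) ^ 4 = 0 := by
  have h5 := pow_five_eq_one hz
  rw [pow_eq_pow_mod n h5]
  have : n % 5 = 1 ∨ n % 5 = 2 ∨ n % 5 = 3 ∨ n % 5 = 4 := by omega
  rcases this with h | h | h | h <;> rw [h]
  · linear_combination hz
  · linear_combination hz + (z + z ^ 3) * h5
  · linear_combination hz + (z + z ^ 4 + z ^ 2 * (z ^ 5 + 1)) * h5
  · linear_combination hz + (z ^ 3 + z ^ 2 * (z ^ 5 + 1) + z * (z ^ 10 + z ^ 5 + 1)) * h5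

lemma not_five_dvd_prime (hp : p.Prime) (hp5 : 5 < p) : ¬ 5 ∣ p := fun h => by
  have := (Nat.prime_dvd_prime_iff_eq Nat.prime_five hp).mp h
  omega

/-- Modulo `p ^ 2`, the `p`-th power of the golden unit `-(ζ ^ 2 + ζ ^ 3)` differs from its
Frobenius conjugate by a multiple of `residueSum p c 2`. -/
lemma golden_pow_prime (hp : p.Prime) (hp5 : 5 < p) (hp2 : (p : R) ^ 2 = 0)
    (hc : ∀ j ∈ Ico 1 p, (j : R) * c j = 1) {ζ : R}
    (hζ : 1 + ζ + ζ ^ 2 + ζ ^ 3 + ζ ^ 4 = 0) :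
    (-(ζ ^ 2 + ζ ^ 3)) ^ p = -((ζ ^ p) ^ 2 + (ζ ^ p) ^ 3)
      - (2 - ((ζ ^ p) ^ 2 + (ζ ^ p) ^ 3)) * (p * residueSum p c 2) := by
  have hndvd : ¬ 5 ∣ p := not_five_dvd_prime hp hp5
  have hodd : Odd p := hp.odd_of_ne_two (by omega)
  have hζ5 := pow_five_eq_one hζ
  have hL1 := mul_sum_mul_pow_eq hndvd (by omega) hp2 hc hζ5
  have hL2 := mul_sum_mul_pow_eq hndvd (by omega) hp2 hc (z := ζ ^ 2)
    (by rw [← pow_mul, mul_comm, pow_mul, hζ5, one_pow])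
  have b1 := one_sub_pow_prime hp hp2 hodd hc ζ
  have b2 := one_sub_pow_prime hp hp2 hodd hc (ζ ^ 2)
  have b3 := one_sub_pow_prime hp hp2 hodd hc (-ζ)
  have hω := geom_sum_pow_eq_zero hζ hndvd
  have hA : (1 - -ζ) ^ p = -((-(ζ ^ 2 + ζ ^ 3)) ^ p * (ζ ^ p) ^ 3) := by
    rw [← pow_mul, mul_comm p 3, pow_mul, ← mul_pow, ← hodd.neg_pow]
    congr 1
    linear_combination (-1 - ζ) * hζ5
  have hfac : (1 - ζ ^ 2) ^ p = (1 - -ζ) ^ p * (1 - ζ) ^ p := by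
    rw [← mul_pow]; congr 1; ring
  have hpow : (ζ ^ 2) ^ p = (ζ ^ p) ^ 2 := by rw [← pow_mul, ← pow_mul, mul_comm]
  rw [hpow] at hL2 b2
  rw [hodd.neg_pow] at b3
  rw [hL1] at b1
  rw [hL2] at b2
  rw [b1, b2] at hfac
  have hpA : (p : R) * (1 - -ζ) ^ p = p * (1 + ζ ^ p) := by
    rw [b3]
    linear_combination (-∑ j ∈ Ico 1 p, c j * (-ζ) ^ j) * hp2
  have hfive := hc 5 (mem_Ico.mpr ⟨by norm_num, hp5⟩)
  push_cast at hfive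
  rw [hA] at hfac hpA
  generalize (-(ζ ^ 2 + ζ ^ 3)) ^ p = Φ at *
  generalize ζ ^ p = ω at *
  generalize residueSum p c 2 = T at *
  generalize residueSum p c 0 = S at *
  have hω5 := pow_five_eq_one hω
  have hE : (1 - ω) * (Φ + (ω ^ 2 + ω ^ 3) + (2 - (ω ^ 2 + ω ^ 3)) * (p * T)) = 0 := by
    linear_combination ω ^ 2 * (hfac - (S * (1 - ω) + T * (ω ^ 2 - ω ^ 4)) * hpA)
      - (Φ * (1 - ω) + p * T * (2 - 2 * ω - ω ^ 2 + ω ^ 5)) * hω5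
  linear_combination c 5 * (4 + 3 * ω + 2 * ω ^ 2 + ω ^ 3) * hE
    - (Φ + (ω ^ 2 + ω ^ 3) + (2 - (ω ^ 2 + ω ^ 3)) * (p * T)) * (hfive - c 5 * hω)

end SquareZero

lemma pow_succ_eq_fib {R : Type*} [CommRing R] {x : R} (hx : x ^ 2 = x + 1) (n : ℕ) :
    x ^ (n + 1) = Nat.fib (n + 1) * x + Nat.fib n := by
  induction n with
  | zero => simp
  | succ n ih =>
    rw [pow_succ, ih, Nat.fib_add_two]
    push_cast
    linear_combination (Nat.fib (n + 1) : R) * hx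

/-- The index `p - (5/p)` of the Fibonacci number divisible by the prime `p`. -/
lemma sub_legendreSym_five_toNat {p : ℕ} [Fact p.Prime] (hp : 5 < p) :
    ((p : ℤ) - legendreSym p 5).toNat =
      if p % 5 = 1 ∨ p % 5 = 4 then p - 1 else p + 1 := by
  have hndvd : ¬ 5 ∣ p := not_five_dvd_prime Fact.out hp
  have hrec := legendreSym.quadratic_reciprocity_one_mod_four (p := 5) (q := p) (by norm_num)
    (by omega)
  push_cast at hrec
  rw [hrec, legendreSym.mod]
  have : p % 5 = 1 ∨ p % 5 = 2 ∨ p % 5 = 3 ∨ p % 5 = 4 := by omega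
  have hmod : (p : ℤ) % (5 : ℕ) = ((p % 5 : ℕ) : ℤ) := by norm_cast
  rw [hmod]
  have l1 : legendreSym 5 ((1 : ℕ) : ℤ) = 1 := by decide
  have l2 : legendreSym 5 ((2 : ℕ) : ℤ) = -1 := by decide
  have l3 : legendreSym 5 ((3 : ℕ) : ℤ) = -1 := by decide
  have l4 : legendreSym 5 ((4 : ℕ) : ℤ) = 1 := by decide
  rcases this with h | h | h | h <;> rw [h] <;> simp only [l1, l2, l3, l4] <;> simp

lemma golden_sq {R : Type*} [CommRing R] {z : R} (hz : 1 + z + z ^ 2 + z ^ 3 + z ^ 4 = 0) :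
    (-(z ^ 2 + z ^ 3)) ^ 2 = -(z ^ 2 + z ^ 3) + 1 := by
  linear_combination (2 + z) * pow_five_eq_one hz + hz

lemma golden_conj {R : Type*} [CommRing R] {z : R} (hz : 1 + z + z ^ 2 + z ^ 3 + z ^ 4 = 0)
    {n : ℕ} (hn : ¬ 5 ∣ n) :
    -((z ^ n) ^ 2 + (z ^ n) ^ 3) =
      if n % 5 = 1 ∨ n % 5 = 4 then -(z ^ 2 + z ^ 3) else 1 - -(z ^ 2 + z ^ 3) := by
  have h5 := pow_five_eq_one hz
  rw [pow_eq_pow_mod n h5]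
  have : n % 5 = 1 ∨ n % 5 = 2 ∨ n % 5 = 3 ∨ n % 5 = 4 := by omega
  rcases this with h | h | h | h <;> simp only [h] <;> norm_num
  · linear_combination -hz - z * h5
  · linear_combination -hz - (z + z ^ 4) * h5
  · linear_combination (-z ^ 3 - z ^ 2 * (z ^ 5 + 1)) * h5

lemma fib_eq_of_root {R : Type*} [CommRing R] {p : ℕ} [hpf : Fact p.Prime] (hp : 5 < p)
    {c : ℕ → R} (hp2 : (p : R) ^ 2 = 0) (hc : ∀ j ∈ Ico 1 p, (j : R) * c j = 1) {ζ : R}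
    (hζ : 1 + ζ + ζ ^ 2 + ζ ^ 3 + ζ ^ 4 = 0) :
    (Nat.fib ((p : ℤ) - legendreSym p 5).toNat : R) = 2 * (p * residueSum p c 4) := by
  have hndvd : ¬ 5 ∣ p := not_five_dvd_prime Fact.out hp
  have hζ2 := geom_sum_pow_eq_zero hζ (n := 2) (by norm_num)
  have hg1 := golden_pow_prime hpf.out hp hp2 hc hζ
  have hg2 := golden_pow_prime hpf.out hp hp2 hc hζ2
  have hT := mul_residueSum_one_sub hp2 hc 2
  rw [show (1 - 2 : ZMod 5) = 4 by decide] at hT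
  have hfive := hc 5 (mem_Ico.mpr ⟨by norm_num, hp⟩)
  push_cast at hfive
  have hx2 := golden_sq hζ2
  have hx1 := golden_sq hζ
  obtain ⟨n, rfl⟩ : ∃ n, p = n + 1 := ⟨p - 1, by omega⟩
  rw [sub_eq_add_neg (2 : R), golden_conj hζ hndvd, pow_succ_eq_fib hx1] at hg1
  rw [sub_eq_add_neg (2 : R), golden_conj hζ2 hndvd, pow_succ_eq_fib hx2,
    golden_conj hζ (n := 2) (by norm_num)] at hg2
  rw [hT, sub_legendreSym_five_toNat hp]
  generalize ((n + 1 : ℕ) : R) * residueSum (n + 1) c 2 = t at *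
  generalize -(ζ ^ 2 + ζ ^ 3) = x at *
  norm_num at hg2
  split_ifs at hg1 hg2 ⊢
  · have hF : (Nat.fib (n + 1) : R) - 1 + t = 0 := by
      linear_combination c 5 * (2 * x - 1) * (hg1 - hg2)
        - (Nat.fib (n + 1) - 1 + t) * (hfive + 4 * c 5 * hx1)
    rw [Nat.add_sub_cancel]
    linear_combination hg1 - x * hF
  · have hF : (Nat.fib (n + 1) : R) + 1 - t = 0 := by
      linear_combination c 5 * (2 * x - 1) * (hg1 - hg2)
        - (Nat.fib (n + 1) + 1 - t) * (hfive + 4 * c 5 * hx1)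
    rw [Nat.fib_add_two]
    push_cast
    linear_combination hg1 + (1 - x) * hF

lemma fib_eq_of_sq_eq_zero {S : Type*} [CommRing S] [Nontrivial S] {p : ℕ} [Fact p.Prime]
    (hp : 5 < p) {c : ℕ → S} (hp2 : (p : S) ^ 2 = 0)
    (hc : ∀ j ∈ Ico 1 p, (j : S) * c j = 1) :
    (Nat.fib ((p : ℤ) - legendreSym p 5).toNat : S) = 2 * (p * residueSum p c 4) := by
  let f : Polynomial S :=
    1 + Polynomial.X + Polynomial.X ^ 2 + Polynomial.X ^ 3 + Polynomial.X ^ 4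
  have hdeg : f.natDegree = 4 := by simp only [f]; compute_degree!
  have hmonic : f.Monic := by simp only [f]; monicity!
  have hinj : Function.Injective (AdjoinRoot.of f) := by
    rw [injective_iff_map_eq_zero]
    intro x hx
    by_contra hx0
    refine hmonic.not_dvd_of_natDegree_lt (Polynomial.C_ne_zero.mpr hx0) ?_
      (AdjoinRoot.mk_eq_zero.mp (hx : AdjoinRoot.mk f (Polynomial.C x) = 0))
    rw [Polynomial.natDegree_C, hdeg]
    norm_num
  have hroot : 1 + AdjoinRoot.root f + AdjoinRoot.root f ^ 2 + AdjoinRoot.root f ^ 3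
      + AdjoinRoot.root f ^ 4 = 0 := by
    simpa [f] using AdjoinRoot.eval₂_root f
  have h := fib_eq_of_root hp (c := fun j => AdjoinRoot.of f (c j))
    (by simpa using congrArg (AdjoinRoot.of f) hp2)
    (fun j hj => by simpa using congrArg (AdjoinRoot.of f) (hc j hj)) hroot
  apply hinj
  simpa [residueSum, map_ofNat (AdjoinRoot.of f) 2] using h

lemma castHom_eq_zero_of_mul_eq_zero {p : ℕ} (hp : p.Prime) {x : ZMod (p ^ 2)}
    (hx : (p : ZMod (p ^ 2)) * x = 0) :
    ZMod.castHom (dvd_pow_self p two_ne_zero) (ZMod p) x = 0 := by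
  have : NeZero (p ^ 2) := ⟨pow_ne_zero 2 hp.ne_zero⟩
  obtain ⟨n, rfl⟩ := ZMod.natCast_zmod_surjective x
  rw [map_natCast, ZMod.natCast_eq_zero_iff]
  rw [← Nat.cast_mul, ZMod.natCast_eq_zero_iff, sq] at hx
  exact Nat.dvd_of_mul_dvd_mul_left hp.pos hx

lemma fib_div_prime_eq {p : ℕ} [hpf : Fact p.Prime] (hp : 5 < p) :
    ((((Nat.fib (((p : ℤ) - legendreSym p 5).toNat) : ℤ) / (p : ℤ)) : ℤ) : ZMod p) =
      2 * residueSum p (fun j => (j : ZMod p)⁻¹) 4 := by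
  have hp0 : (p : ℤ) ≠ 0 := by exact_mod_cast hpf.out.ne_zero
  have : Nontrivial (ZMod (p ^ 2)) := ZMod.nontrivial_iff.mpr (by nlinarith)
  have hp2 : (p : ZMod (p ^ 2)) ^ 2 = 0 := by exact_mod_cast ZMod.natCast_self (p ^ 2)
  have hc : ∀ j ∈ Ico 1 p, (j : ZMod (p ^ 2)) * (j : ZMod (p ^ 2))⁻¹ = 1 := fun j hj => by
    refine ZMod.coe_mul_inv_eq_one j (Nat.Coprime.pow_right 2 ?_)
    rw [mem_Ico] at hj
    exact (Nat.coprime_of_lt_prime (by omega) hj.2 hpf.out).symm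
  have hfib := fib_eq_of_sq_eq_zero hp hp2 hc
  generalize Nat.fib ((p : ℤ) - legendreSym p 5).toNat = F at *
  let φ := ZMod.castHom (dvd_pow_self p two_ne_zero) (ZMod p)
  have hdvd : p ∣ F := by
    have := congrArg φ hfib
    rw [← ZMod.natCast_eq_zero_iff]
    simpa using this
  obtain ⟨q, rfl⟩ := hdvd
  have hq := castHom_eq_zero_of_mul_eq_zero hpf.out
    (x := q - 2 * residueSum p (fun j => (j : ZMod (p ^ 2))⁻¹) 4)
    (by push_cast at hfib; linear_combination hfib)
  have hsum : φ (residueSum p (fun j => (j : ZMod (p ^ 2))⁻¹) 4) =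
      residueSum p (fun j => (j : ZMod p)⁻¹) 4 := by
    rw [residueSum, residueSum, map_sum]
    refine sum_congr rfl fun j hj => eq_inv_of_mul_eq_one_right ?_
    have := congrArg φ (hc j (mem_filter.mp hj).1)
    simpa using this
  rw [map_sub, map_mul, sub_eq_zero, map_natCast, map_ofNat] at hq
  rw [← hsum, ← hq]
  push_cast
  rw [mul_comm, Int.mul_ediv_cancel _ hp0]
  simp

lemma harmonic_den_dvd_factorial (n : ℕ) : (harmonic n).den ∣ n.factorial := by
  induction n with
  | zero => simp
  | succ n ih =>
    rw [harmonic_succ, Nat.factorial_succ, mul_comm]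
    refine (Rat.add_den_dvd _ _).trans (mul_dvd_mul ih ?_)
    rw [Rat.inv_natCast_den_of_pos n.succ_pos]

lemma harmonic_den_cast_ne_zero {p n : ℕ} [hpf : Fact p.Prime] (hn : n < p) :
    ((harmonic n).den : ZMod p) ≠ 0 := by
  rw [Ne, ZMod.natCast_eq_zero_iff]
  intro h
  exact hn.not_ge ((hpf.out.dvd_factorial).mp (h.trans (harmonic_den_dvd_factorial n)))

lemma harmonic_cast_zmod {p n : ℕ} [hpf : Fact p.Prime] (hn : n < p) :
    ((harmonic n : ℚ) : ZMod p) = ∑ j ∈ Ico 1 (n + 1), (j : ZMod p)⁻¹ := by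
  induction n with
  | zero => simp
  | succ n ih =>
    have hden : (((((n + 1 : ℕ) : ℚ)⁻¹).den : ℕ) : ZMod p) ≠ 0 := by
      rw [Rat.inv_natCast_den_of_pos n.succ_pos, Ne, ZMod.natCast_eq_zero_iff]
      exact Nat.not_dvd_of_pos_of_lt n.succ_pos hn
    rw [harmonic_succ, Rat.cast_add_of_ne_zero (harmonic_den_cast_ne_zero (by omega)) hden,
      ih (by omega), sum_Ico_succ_top (by omega : 1 ≤ n + 1)]
    rw [Rat.cast_inv_nat]

lemma five_mul_residueSum_four {p : ℕ} [hpf : Fact p.Prime] (hp : 5 < p) :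
    5 * residueSum p (fun j => (j : ZMod p)⁻¹) 4 =
      ∑ j ∈ Ico (p / 5 + 1) (2 * p / 5 + 1), (j : ZMod p)⁻¹ := by
  have hndvd : ¬ 5 ∣ p := not_five_dvd_prime Fact.out hp
  have hmem : ∀ k : ℕ, (k : ZMod 5) = 4 * p ↔ 5 ∣ k + p := fun k => by
    rw [← ZMod.natCast_eq_zero_iff, ← sub_eq_zero, show (4 : ZMod 5) = -1 by decide]
    simp
  rw [residueSum, mul_sum]
  refine sum_nbij' (fun k => (k + p) / 5) (fun j => 5 * j - p) ?_ ?_ ?_ ?_ ?_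
  · intro k hk
    simp only [mem_filter, mem_Ico, hmem] at hk ⊢
    omega
  · intro j hj
    simp only [mem_filter, mem_Ico, hmem] at hj ⊢
    have : 5 * j ≠ 2 * p := by omega
    omega
  · intro k hk
    simp only [mem_filter, mem_Ico, hmem] at hk ⊢
    omega
  · intro j hj
    simp only [mem_Ico] at hj ⊢
    omega
  · intro k hk
    simp only [mem_filter, mem_Ico, hmem] at hk
    obtain ⟨⟨hk1, hk2⟩, j, hj⟩ := hk
    rw [hj, Nat.mul_div_cancel_left j (by norm_num)]
    have h5 : (5 : ZMod p) ≠ 0 := by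
      have := mt (ZMod.natCast_eq_zero_iff 5 p).mp (Nat.not_dvd_of_pos_of_lt (by norm_num) hp)
      exact_mod_cast this
    have hkj : (k : ZMod p) = 5 * j := by
      have := congrArg (Nat.cast : ℕ → ZMod p) hj
      push_cast at this
      simpa using this
    rw [hkj, mul_inv, mul_inv_cancel_left₀ h5]

/-- **Williams's congruence via harmonic numbers.**
For a prime `p > 5` with `ε = (5/p)` the Legendre symbol,
`5·(F_{p−ε}/p) ≡ 2·(H_{⌊2p/5⌋} − H_{⌊p/5⌋}) (mod p)`, where `H_n` is the `n`-th
harmonic number in `ℚ`, cast into `ℤ/pℤ`. -/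
theorem williams_fibonacci_quotient_harmonic (p : ℕ) [Fact p.Prime] (hp : 5 < p) :
    (5 : ZMod p) *
      ((((Nat.fib (((p : ℤ) - legendreSym p 5).toNat) : ℤ) / (p : ℤ)) : ℤ) : ZMod p) =
    2 * ((harmonic (2 * p / 5) - harmonic (p / 5) : ℚ) : ZMod p) := by
  have hlt : 2 * p / 5 < p := by omega
  have hlt' : p / 5 < p := by omega
  rw [fib_div_prime_eq hp,
    Rat.cast_sub_of_ne_zero (harmonic_den_cast_ne_zero hlt) (harmonic_den_cast_ne_zero hlt'),
    harmonic_cast_zmod hlt, harmonic_cast_zmod hlt', mul_left_comm, five_mul_residueSum_four hp,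
    ← sum_Ico_consecutive _ (by omega : 1 ≤ p / 5 + 1) (by omega : p / 5 + 1 ≤ 2 * p / 5 + 1),
    add_sub_cancel_left]
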